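/- arXiv:1901.09818 — 2 statements merged into one kernel-verified Lean document; each statement's English description precedes it below -/
import Mathlib

section
/- If d is a base-3/2 digit string whose value v(d) is an integer N with N ≥ 8, and k is the largest index with d k ≠ 0, then k ≥ 2, d k = 2, d (k−1) = 1, and d (k−2) ∈ {0, 2}; that is, the base-3/2 representation of every integer greater than or equal to 8 starts with 21 followed by either 0 or 2. -/
/-- The value of a base-3/2 digit string. -/
def val32 (d : ℕ →₀ ℕ) : ℚ := d.sum fun i c => (c : ℚ) * (3 / 2 : ℚ) ^ i

theorem sum_range_succ_eq_add_shift (d : ℕ → ℕ) (n : ℕ) :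
    ∑ i ∈ Finset.range (n + 1), (d i : ℚ) * (3 / 2) ^ i =
      d 0 + 3 / 2 * ∑ i ∈ Finset.range n, (d (i + 1) : ℚ) * (3 / 2) ^ i := by
  rw [Finset.sum_range_succ', Finset.mul_sum, add_comm]
  congr 1
  · simp
  · exact Finset.sum_congr rfl fun i _ => by ring

theorem exists_int_eq_two_pow_mul_sum (d : ℕ → ℕ) (n : ℕ) :
    ∃ m : ℤ, 2 ^ n * ∑ i ∈ Finset.range n, (d i : ℚ) * (3 / 2) ^ i = m := by
  induction n with
  | zero => exact ⟨0, by simp⟩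
  | succ n ih =>
    obtain ⟨m, hm⟩ := ih
    refine ⟨2 * m + 2 * d n * 3 ^ n, ?_⟩
    have h : (2 : ℚ) ^ n * (3 / 2) ^ n = 3 ^ n := by rw [← mul_pow]; norm_num
    rw [Finset.sum_range_succ]
    push_cast
    rw [← hm, ← h]
    ring

/-- Dropping the last digit of an expansion of an integer leaves an expansion of an even integer. -/
theorem exists_shift_sum_eq_two_mul (d : ℕ → ℕ) (n : ℕ) (N : ℤ)
    (h : ∑ i ∈ Finset.range (n + 1), (d i : ℚ) * (3 / 2) ^ i = N) :
    ∃ M : ℤ, ∑ i ∈ Finset.range n, (d (i + 1) : ℚ) * (3 / 2) ^ i = (2 * M : ℤ) ∧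
      N = d 0 + 3 * M := by
  rw [sum_range_succ_eq_add_shift] at h
  obtain ⟨m, hm⟩ := exists_int_eq_two_pow_mul_sum (fun i => d (i + 1)) n
  set s := ∑ i ∈ Finset.range n, (d (i + 1) : ℚ) * (3 / 2) ^ i
  have hs : 3 * s = 2 * (N - d 0) := by linarith
  have hZ : 2 ^ n * (2 * (N - d 0)) = 3 * m := by
    have : (2 : ℚ) ^ n * (2 * (N - d 0)) = 3 * m := by rw [← hs, ← hm]; ring
    exact_mod_cast this
  have hdvd : (3 : ℤ) ∣ 2 ^ (n + 1) * (N - d 0) := ⟨m, by rw [← hZ]; ring⟩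
  have hcop : IsCoprime (3 : ℤ) (2 ^ (n + 1)) := IsCoprime.pow_right ⟨1, -1, by norm_num⟩
  obtain ⟨M, hM⟩ := hcop.dvd_of_dvd_mul_left hdvd
  refine ⟨M, ?_, by linarith⟩
  have hMq : (N : ℚ) - d 0 = 3 * M := by exact_mod_cast hM
  push_cast
  linarith

theorem leading_digits_of_sum_eq_int (k : ℕ) (d : ℕ → ℕ) (hd : ∀ i, d i ≤ 2) (N : ℤ)
    (h : ∑ i ∈ Finset.range (k + 3), (d i : ℚ) * (3 / 2) ^ i = N) (hk : d (k + 2) ≠ 0) :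
    6 ≤ N ∧ (N ≠ 7 → d (k + 2) = 2 ∧ d (k + 1) = 1 ∧ (d k = 0 ∨ d k = 2)) := by
  induction k generalizing d N with
  | zero =>
    have h4 : (9 * d 2 + 6 * d 1 + 4 * d 0 : ℤ) = 4 * N := by
      have : (9 * d 2 + 6 * d 1 + 4 * d 0 : ℚ) = 4 * N := by
        rw [← h]; simp [Finset.sum_range_succ]; ring
      exact_mod_cast this
    have := hd 0
    have := hd 1
    have := hd 2
    simp only [zero_add] at hk ⊢
    omega
  | succ k ih =>
    obtain ⟨M, hM, hN⟩ := exists_shift_sum_eq_two_mul d (k + 3) N h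
    obtain ⟨h6, hlead⟩ := ih (fun i => d (i + 1)) (fun i => hd _) (2 * M) hM hk
    exact ⟨by omega, fun _ => hlead (by omega)⟩

theorem val32_eq_sum_range (d : ℕ →₀ ℕ) (k : ℕ) (hmax : ∀ i, k < i → d i = 0) :
    val32 d = ∑ i ∈ Finset.range (k + 1), (d i : ℚ) * (3 / 2) ^ i := by
  refine Finsupp.sum_of_support_subset d (fun i hi => ?_) _ (by simp)
  rw [Finset.mem_range]
  by_contra hlt
  exact Finsupp.mem_support_iff.mp hi (hmax i (by omega))

/-- The base-3/2 representation of every integer `N ≥ 8` starts with `21`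
followed by either 0 or 2. -/
theorem base32_starts_with_21_then_0_or_2 (d : ℕ →₀ ℕ) (hd : ∀ i, d i ≤ 2)
    (N : ℤ) (hN : 8 ≤ N) (hval : val32 d = N)
    (k : ℕ) (hk : d k ≠ 0) (hmax : ∀ i, k < i → d i = 0) :
    2 ≤ k ∧ d k = 2 ∧ d (k - 1) = 1 ∧ (d (k - 2) = 0 ∨ d (k - 2) = 2) := by
  rw [val32_eq_sum_range d k hmax] at hval
  have hNq : (8 : ℚ) ≤ N := by exact_mod_cast hN
  have h0 : (d 0 : ℚ) ≤ 2 := by exact_mod_cast hd 0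
  have h1 : (d 1 : ℚ) ≤ 2 := by exact_mod_cast hd 1
  match k with
  | 0 =>
    simp at hval
    linarith
  | 1 =>
    simp [Finset.sum_range_succ] at hval
    linarith
  | k + 2 =>
    exact ⟨by omega, (leading_digits_of_sum_eq_int k d hd N hval hk).2 (by omega)⟩
end

section
/- Let a be a base-1.5 digit string and suppose j is the least index with a j = 0 (such j exists since a is finitely supported). Define b : ℕ → ℚ by b i = a i for i > j, b j = 1, and for i < j, b i = 0 if a i = 1/2 and b i = 1/2 if a i = 1. Then b is a base-1.5 digit string and its value equals the value of a plus 1; that is, the cyclic digit-replacement algorithm 0 → 1 → H → 0 applied at and after the last zero correctly increments a number by 1 in base 1.5. -/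
/-- The value of a base-1.5 digit string. -/
def val15 (a : ℕ →₀ ℚ) : ℚ := a.sum fun i c => c * (3 / 2 : ℚ) ^ i

/-- `a` is a base-1.5 digit string: each digit is 0, H = 1/2, or 1. -/
def IsBase15 (a : ℕ →₀ ℚ) : Prop := ∀ i, a i = 0 ∨ a i = 1 / 2 ∨ a i = 1

theorem val15_eq_sum_range {a : ℕ →₀ ℚ} {n : ℕ} (h : a.support ⊆ Finset.range n) :
    val15 a = ∑ i ∈ Finset.range n, a i * (3 / 2 : ℚ) ^ i :=
  Finsupp.sum_of_support_subset a h _ fun _ _ => zero_mul _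

/-- Lowering each of the first `n` digits by `1 / 2` lowers the value by `(3 / 2) ^ n - 1`. -/
theorem sum_range_sub_half (a : ℕ → ℚ) (n : ℕ) :
    ∑ i ∈ Finset.range n, (a i - 1 / 2) * (3 / 2 : ℚ) ^ i + (3 / 2 : ℚ) ^ n =
      ∑ i ∈ Finset.range n, a i * (3 / 2 : ℚ) ^ i + 1 := by
  induction n with
  | zero => simp
  | succ n ih =>
    rw [Finset.sum_range_succ, Finset.sum_range_succ, pow_succ]
    linear_combination ih

/-- The cyclic digit-replacement algorithm `0 → 1 → H → 0`, applied at and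
after the last zero, correctly increments a number by 1 in base 1.5. -/
theorem base15_increment_algorithm (a : ℕ →₀ ℚ) (ha : IsBase15 a)
    (j : ℕ) (hj : a j = 0) (hjmin : ∀ i < j, a i ≠ 0)
    (b : ℕ →₀ ℚ)
    (hb_gt : ∀ i, j < i → b i = a i)
    (hb_j : b j = 1)
    (hb_lt : ∀ i < j, (a i = 1 / 2 → b i = 0) ∧ (a i = 1 → b i = 1 / 2)) :
    IsBase15 b ∧ val15 b = val15 a + 1 := by
  have hlt : ∀ i < j, (b i = 0 ∨ b i = 1 / 2) ∧ b i = a i - 1 / 2 := by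
    intro i hi
    rcases ha i with h | h | h
    · exact absurd h (hjmin i hi)
    · have hb := (hb_lt i hi).1 h
      exact ⟨.inl hb, by rw [hb, h]; norm_num⟩
    · have hb := (hb_lt i hi).2 h
      exact ⟨.inr hb, by rw [hb, h]; norm_num⟩
  refine ⟨fun i => ?_, ?_⟩
  · rcases lt_trichotomy i j with hi | rfl | hi
    · exact (hlt i hi).1.imp_right .inl
    · exact .inr (.inr hb_j)
    · rw [hb_gt i hi]
      exact ha i
  · obtain ⟨n, hn⟩ := (a.support ∪ b.support).exists_nat_subset_range
    have hn' : a.support ∪ b.support ⊆ Finset.range (j + 1 + n) :=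
      hn.trans (Finset.range_subset_range.2 (Nat.le_add_left _ _))
    have hlow : ∑ i ∈ Finset.range j, b i * (3 / 2 : ℚ) ^ i =
        ∑ i ∈ Finset.range j, (a i - 1 / 2) * (3 / 2 : ℚ) ^ i :=
      Finset.sum_congr rfl fun i hi => by rw [(hlt i (Finset.mem_range.1 hi)).2]
    have hhigh : ∑ i ∈ Finset.range n, b (j + 1 + i) * (3 / 2 : ℚ) ^ (j + 1 + i) =
        ∑ i ∈ Finset.range n, a (j + 1 + i) * (3 / 2 : ℚ) ^ (j + 1 + i) :=
      Finset.sum_congr rfl fun i _ => by rw [hb_gt (j + 1 + i) (by omega)]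
    rw [val15_eq_sum_range (Finset.union_subset_right hn'),
      val15_eq_sum_range (Finset.union_subset_left hn'),
      Finset.sum_range_add _ (j + 1) n, Finset.sum_range_add _ (j + 1) n,
      Finset.sum_range_succ _ j, Finset.sum_range_succ _ j, hlow, hhigh, hj, hb_j]
    linear_combination sum_range_sub_half a j
end
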